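/- arXiv:2309.01044 — 5 statements merged into one kernel-verified Lean document; each statement's English description precedes it below -/
import Mathlib

section
/- Let R be a commutative noetherian ring and m a maximal ideal of R. Then every KE-closed subcategory X of mod R with Ass X = {m} equals mod^ass_{m} R, the subcategory of finitely generated R-modules whose associated primes are contained in {m}. -/
/-! Statement 14: Let `R` be a commutative noetherian ring and `m` a maximal
ideal of `R`. Then every KE-closed subcategory `X` of `mod R` with
`Ass X = {m}` equals `mod^ass_{m} R`. -/

open CategoryTheory

universe u

section Defs

variable (R : Type u) [CommRing R]

/-- `P` is a class of finitely generated `R`-modules (a subcategory of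
`mod R`). -/
def IsSubcatOfFGMod (P : ModuleCat.{u} R → Prop) : Prop :=
  ∀ M : ModuleCat.{u} R, P M → Module.Finite R M

/-- `P` is an additive subcategory: it contains the zero modules and is
closed under isomorphisms and finite direct sums. -/
def MIsAdditive (P : ModuleCat.{u} R → Prop) : Prop :=
  (∀ M : ModuleCat.{u} R, Subsingleton M → P M) ∧
  (∀ M N : ModuleCat.{u} R, (M ≃ₗ[R] N) → P M → P N) ∧
  (∀ M N : ModuleCat.{u} R, P M → P N → P (ModuleCat.of R (M × N)))

/-- `P` is closed under submodules. -/
def MClosedUnderSubmodules (P : ModuleCat.{u} R → Prop) : Prop :=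
  ∀ (M : ModuleCat.{u} R) (N : Submodule R M), P M → P (ModuleCat.of R N)

/-- `P` is closed under kernels of `R`-linear maps between its members. -/
def MClosedUnderKernels (P : ModuleCat.{u} R → Prop) : Prop :=
  ∀ (M N : ModuleCat.{u} R) (f : M →ₗ[R] N), P M → P N →
    P (ModuleCat.of R (LinearMap.ker f))

/-- `P` is closed under extensions: for every short exact sequence
`0 → N → M → M/N → 0`, if the two outer terms lie in `P` then so does `M`.
(Together with closure under isomorphisms this is equivalent to the usual
formulation with arbitrary short exact sequences.) -/
def MClosedUnderExtensions (P : ModuleCat.{u} R → Prop) : Prop :=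
  ∀ (M : ModuleCat.{u} R) (N : Submodule R M),
    P (ModuleCat.of R N) → P (ModuleCat.of R (M ⧸ N)) → P M

/-- `P` is a torsion-free class of `mod R`: an additive subcategory of
finitely generated modules closed under submodules and extensions. -/
def MIsTorsionFreeClass (P : ModuleCat.{u} R → Prop) : Prop :=
  IsSubcatOfFGMod R P ∧ MIsAdditive R P ∧ MClosedUnderSubmodules R P ∧
    MClosedUnderExtensions R P

/-- `P` is a KE-closed subcategory of `mod R`: an additive subcategory of
finitely generated modules closed under kernels and extensions. -/
def MIsKEClosed (P : ModuleCat.{u} R → Prop) : Prop :=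
  IsSubcatOfFGMod R P ∧ MIsAdditive R P ∧ MClosedUnderKernels R P ∧
    MClosedUnderExtensions R P

/-- `Ass X`: the union of the associated primes of members of `X`. -/
def AssOf (P : ModuleCat.{u} R → Prop) : Set (Ideal R) :=
  {p | ∃ M : ModuleCat.{u} R, P M ∧ p ∈ associatedPrimes R M}

/-- `mod^ass_Φ R`: the finitely generated modules all of whose associated
primes lie in `Φ`. -/
def modAss (Φ : Set (Ideal R)) : ModuleCat.{u} R → Prop :=
  fun M => Module.Finite R M ∧ associatedPrimes R M ⊆ Φ

end Defs

/-- A class of modules closed under isomorphisms and binary products that contains the zero modules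
is closed under finite powers. -/
lemma MIsAdditive.pow {R : Type u} [CommRing R] {X : ModuleCat.{u} R → Prop}
    (hX : MIsAdditive R X) {M : ModuleCat.{u} R} (hM : X M) (n : ℕ) :
    X (ModuleCat.of R (Fin n → M)) := by
  induction n with
  | zero => exact hX.1 _ (inferInstanceAs (Subsingleton (Fin 0 → M)))
  | succ n ih =>
    exact hX.2.1 (ModuleCat.of R (M × (Fin n → M))) _
      (Fin.consLinearEquiv R (fun _ : Fin (n + 1) => (M : Type u))) (hX.2.2 _ _ hM ih)

/-- A KE-closed subcategory contains the `I`-torsion of each of its members, for `I` finitely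
generated. -/
lemma MIsKEClosed.torsionBySet {R : Type u} [CommRing R] {X : ModuleCat.{u} R → Prop}
    (hX : MIsKEClosed R X) {M : ModuleCat.{u} R} (hM : X M) {I : Ideal R} (hI : I.FG) :
    X (ModuleCat.of R (Submodule.torsionBySet R M I)) := by
  obtain ⟨n, r, rfl⟩ := Submodule.fg_iff_exists_fin_generating_family.mp hI
  let f : M →ₗ[R] (Fin n → M) := LinearMap.pi fun i => LinearMap.lsmul R M (r i)
  have hf : LinearMap.ker f = Submodule.torsionBySet R M (Submodule.span R (Set.range r)) := by
    ext x
    rw [Ideal.submodule_span_eq, ← Submodule.torsionBySet_eq_torsionBySet_span]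
    simp only [f, LinearMap.mem_ker, funext_iff, Submodule.mem_torsionBySet_iff, LinearMap.pi_apply,
      LinearMap.lsmul_apply, Pi.zero_apply, Subtype.forall, Set.forall_mem_range]
  exact hX.2.1.2.1 _ _ (LinearEquiv.ofEq _ _ hf)
    (hX.2.2.1 M (ModuleCat.of R (Fin n → M)) f hM (hX.2.1.pow hM n))

/-- A KE-closed subcategory having the maximal ideal `m` as an associated prime contains the
residue field at `m`. -/
lemma MIsKEClosed.residueField {R : Type u} [CommRing R] [IsNoetherianRing R]
    {X : ModuleCat.{u} R → Prop} (hX : MIsKEClosed R X) {m : Ideal R} (hm : m.IsMaximal)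
    (hmX : m ∈ AssOf R X) : X (ModuleCat.of R (R ⧸ m)) := by
  obtain ⟨M, hM, hmM⟩ := hmX
  obtain ⟨-, x, hx⟩ := isAssociatedPrime_iff.mp hmM
  let _ := Ideal.Quotient.field m
  let S := Submodule.torsionBySet R M m
  have hxS : x ∈ S := by
    rw [Submodule.mem_torsionBySet_iff]
    rintro ⟨a, ha⟩
    rw [SetLike.mem_coe, hx, Submodule.mem_colon_singleton] at ha
    exact (Submodule.mem_bot R).mp ha
  let y : S := ⟨x, hxS⟩
  have hy : y ≠ 0 := by
    intro h
    have h0 : x = 0 := congrArg Subtype.val h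
    apply hm.ne_top
    rw [hx, Ideal.eq_top_iff_one, Submodule.mem_colon_singleton]
    simp [h0]
  obtain ⟨φ, hφ⟩ := Module.Projective.exists_dual_eq_one (R ⧸ m) hy
  let f : S →ₗ[R] S := (LinearMap.id - φ.smulRight y).restrictScalars R
  have hf (z : S) : z ∈ LinearMap.ker f ↔ z = φ z • y := by
    simp [f, sub_eq_zero]
  have hS : X (ModuleCat.of R S) :=
    hX.torsionBySet hM (IsNoetherian.noetherian m)
  let ψ : LinearMap.ker f →ₗ[R] R ⧸ m := φ.restrictScalars R ∘ₗ (LinearMap.ker f).subtype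
  have hψ : Function.Bijective ψ := by
    constructor
    · rintro ⟨a, ha⟩ ⟨b, hb⟩ hab
      have hab' : φ a = φ b := hab
      rw [Subtype.mk.injEq, (hf a).mp ha, (hf b).mp hb, hab']
    · intro c
      have hc : φ (c • y) = c := by rw [map_smul, hφ, smul_eq_mul, mul_one]
      exact ⟨⟨c • y, (hf _).mpr (by rw [hc])⟩, hc⟩
  exact hX.2.1.2.1 _ _ (LinearEquiv.ofBijective ψ hψ)
    (hX.2.2.1 (ModuleCat.of R S) (ModuleCat.of R S) f hS hS)

/-- An additive extension-closed class containing `R ⧸ m` contains every finitely generated module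
whose annihilator lies in no prime ideal other than `m`. -/
lemma mem_of_forall_annihilator_le {R : Type u} [CommRing R] [IsNoetherianRing R]
    {X : ModuleCat.{u} R → Prop} (hadd : MIsAdditive R X) (hext : MClosedUnderExtensions R X)
    {m : Ideal R} (hk : X (ModuleCat.of R (R ⧸ m))) {M : Type u} [AddCommGroup M] [Module R M]
    (hfin : Module.Finite R M)
    (hM : ∀ p : Ideal R, p.IsPrime → Module.annihilator R M ≤ p → p = m) :
    X (ModuleCat.of R M) := by
  induction hfin using IsNoetherianRing.induction_on_isQuotientEquivQuotientPrime with
  | subsingleton N => exact hadd.1 _ ‹_›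
  | quotient N p e =>
    have hp : p.1 = m := hM p.1 p.2 (by rw [e.annihilator_eq, Ideal.annihilator_quotient])
    subst hp
    exact hadd.2.1 _ _ e.symm hk
  | exact N₁ N₂ N₃ f g hf hg hfg h₁ h₃ =>
    refine hext (ModuleCat.of R N₂) (LinearMap.range f)
      (hadd.2.1 (ModuleCat.of R N₁) _ (LinearEquiv.ofInjective f hf) (h₁ fun p hp h => ?_))
      (hadd.2.1 (ModuleCat.of R N₃) _ (hfg.linearEquivOfSurjective hg).symm (h₃ fun p hp h => ?_))
    · exact hM p hp ((f.annihilator_le_of_injective hf).trans h)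
    · exact hM p hp ((g.annihilator_le_of_surjective hg).trans h)

theorem KE_eq_modAss_of_maximal (R : Type u) [CommRing R] [IsNoetherianRing R]
    (m : Ideal R) (hm : m.IsMaximal)
    (X : ModuleCat.{u} R → Prop) (hX : MIsKEClosed R X)
    (hAss : AssOf R X = {m}) :
    ∀ M : ModuleCat.{u} R, X M ↔ modAss R {m} M := by
  intro M
  refine ⟨fun hM => ⟨hX.1 M hM, fun p hp => hAss ▸ ⟨M, hM, hp⟩⟩, fun ⟨hfin, hM⟩ => ?_⟩
  refine mem_of_forall_annihilator_le hX.2.1 hX.2.2.2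
    (hX.residueField hm (hAss ▸ Set.mem_singleton m)) hfin fun p hp hle => ?_
  obtain ⟨q, hq, hqp⟩ := Ideal.exists_minimalPrimes_le hle
  have hqm : q = m :=
    hM (Module.associatedPrimes.minimalPrimes_annihilator_subset_associatedPrimes R M hq)
  exact (hm.eq_of_le hp.ne_top (hqm ▸ hqp)).symm
end

section
/- Let R be a commutative noetherian ring and Φ a subset of Spec R. Suppose that for every p ∈ Φ, the only KE-closed subcategory of mod R with associated-prime set exactly {p} is mod^ass_{p} R. Then the only KE-closed subcategory of mod R with associated-prime set exactly Φ is mod^ass_Φ R. -/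
/-! Statement 15: Let `R` be a commutative noetherian ring and `Φ` a set of
prime ideals of `R`. If for every `p ∈ Φ` the only KE-closed subcategory of
`mod R` with associated-prime set exactly `{p}` is `mod^ass_{p} R`, then the
only KE-closed subcategory of `mod R` with associated-prime set exactly `Φ`
is `mod^ass_Φ R`. -/

open CategoryTheory

universe u

section AssociatedPrimes

variable {R : Type*} [CommRing R] {M : Type*} [AddCommGroup M] [Module R M]

theorem associatedPrimes_subset_union_quotient (Q : Submodule R M) :
    associatedPrimes R M ⊆ associatedPrimes R Q ∪ associatedPrimes R (M ⧸ Q) :=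
  associatedPrimes.subset_union_of_exact Q.injective_subtype (LinearMap.exact_subtype_mkQ Q)

theorem associatedPrimes_submodule_subset (Q : Submodule R M) :
    associatedPrimes R Q ⊆ associatedPrimes R M :=
  associatedPrimes.subset_of_injective Q.injective_subtype

/-- Any set `S` of ideals splits the associated primes of a noetherian module: those of a suitable
submodule avoid `S`, and those of the quotient lie in `S`. -/
theorem exists_disjoint_associatedPrimes_and_quotient_subset [IsNoetherianRing R]
    [IsNoetherian R M] (S : Set (Ideal R)) :
    ∃ Q : Submodule R M, Disjoint (associatedPrimes R Q) S ∧ associatedPrimes R (M ⧸ Q) ⊆ S := by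
  obtain ⟨Q, hQ, hmax⟩ := set_has_maximal_iff_noetherian.mpr ‹IsNoetherian R M›
    {Q : Submodule R M | Disjoint (associatedPrimes R Q) S}
    ⟨⊥, by simp [associatedPrimes.eq_empty_of_subsingleton]⟩
  refine ⟨Q, hQ, fun P hP ↦ ?_⟩
  by_contra hPS
  obtain ⟨hprime, f, hf⟩ := (isAssociatedPrime_iff_exists_injective_linearMap P _).mp hP
  let Q' : Submodule R M := (LinearMap.range f).comap Q.mkQ
  have hle : Q ≤ Q' := fun x hx ↦ by simp [Q', (Submodule.Quotient.mk_eq_zero Q).mpr hx]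
  let g : Q' →ₗ[R] LinearMap.range f := Q.mkQ.restrict fun _ hx ↦ hx
  have hexact : Function.Exact (Submodule.inclusion hle) g := fun x ↦ by
    rw [← Subtype.coe_inj]
    simpa [g] using ⟨fun h ↦ ⟨x, h, rfl⟩, by rintro ⟨a, ha, rfl⟩; exact ha⟩
  have hAss := associatedPrimes.subset_union_of_exact (Submodule.inclusion_injective hle) hexact
  rw [← LinearEquiv.AssociatedPrimes.eq (LinearEquiv.ofInjective f hf),
    associatedPrimes.eq_singleton_of_isPrimary hprime.isPrimary, hprime.radical] at hAss
  refine hmax Q' ?_ (hle.lt_of_ne fun h ↦ ?_)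
  · exact Disjoint.mono_left hAss (hQ.union_left (Set.disjoint_singleton_left.mpr hPS))
  · obtain ⟨x, hx⟩ := Q.mkQ_surjective (f 1)
    have hxQ : x ∈ Q := h ▸ (show Q.mkQ x ∈ LinearMap.range f from hx ▸ ⟨1, rfl⟩)
    have h0 : f 1 = f 0 := by
      rw [← hx, map_zero]
      exact (Submodule.Quotient.mk_eq_zero Q).mpr hxQ
    exact hprime.ne_top ((Ideal.eq_top_iff_one P).mpr (Ideal.Quotient.eq_zero_iff_mem.mp (hf h0)))

end AssociatedPrimes

section KEClosed

variable {R : Type u} [CommRing R] {X : ModuleCat.{u} R → Prop}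

theorem MIsKEClosed.of_quotient (hX : MIsKEClosed R X) (M : ModuleCat.{u} R) (Q : Submodule R M)
    (hM : X M) (hQ : X (ModuleCat.of R (M ⧸ Q))) : X (ModuleCat.of R Q) := by
  have := hX.2.2.1 M (ModuleCat.of R (M ⧸ Q)) Q.mkQ hM hQ
  rwa [Submodule.ker_mkQ] at this

/-- The modules in a KE-closed subcategory with associated primes in `Ψ` form a KE-closed
subcategory. -/
theorem MIsKEClosed.inter_modAss (hX : MIsKEClosed R X) (Ψ : Set (Ideal R)) :
    MIsKEClosed R fun M ↦ X M ∧ associatedPrimes R M ⊆ Ψ := by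
  obtain ⟨hfg, ⟨hzero, hiso, hprod⟩, hker, hext⟩ := hX
  refine ⟨fun M hM ↦ hfg M hM.1, ⟨fun M hM ↦ ⟨hzero M hM, ?_⟩,
    fun M N e hM ↦ ⟨hiso M N e hM.1, LinearEquiv.AssociatedPrimes.eq e ▸ hM.2⟩,
    fun M N hM hN ↦ ⟨hprod M N hM.1 hN.1, ?_⟩⟩,
    fun M N f hM hN ↦ ⟨hker M N f hM.1 hN.1, ?_⟩, fun M N hN hQ ↦ ⟨hext M N hN.1 hQ.1, ?_⟩⟩
  · simp [associatedPrimes.eq_empty_of_subsingleton]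
  · exact (associatedPrimes.prod R M N).trans_subset (Set.union_subset hM.2 hN.2)
  · exact (associatedPrimes_submodule_subset _).trans hM.2
  · exact (associatedPrimes_subset_union_quotient N).trans (Set.union_subset hN.2 hQ.2)

variable [IsNoetherianRing R]

/-- A KE-closed subcategory containing `mod^ass_{p}` for every `p ∈ Ψ` contains
`mod^ass_Ψ`. -/
theorem MIsKEClosed.of_associatedPrimes_subset (hX : MIsKEClosed R X) {Ψ : Set (Ideal R)}
    (hΨ : ∀ p ∈ Ψ, ∀ M, modAss R {p} M → X M) (M : ModuleCat.{u} R) (hM : modAss R Ψ M) :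
    X M := by
  induction hn : (associatedPrimes R M).ncard using Nat.strong_induction_on generalizing M with
  | _ n ih =>
  have := hM.1
  rcases subsingleton_or_nontrivial M with hs | hnt
  · exact hX.2.1.1 M hs
  obtain ⟨p, hp⟩ := associatedPrimes.nonempty R M
  obtain ⟨Q, hQ, hQ'⟩ := exists_disjoint_associatedPrimes_and_quotient_subset (R := R) (M := M)
    (associatedPrimes R M \ {p})
  refine hX.2.2.2 M Q (hΨ p (hM.2 hp) _ ⟨inferInstanceAs (Module.Finite R Q), fun q hq ↦ ?_⟩)
    (ih _ ?_ _ ⟨inferInstanceAs (Module.Finite R (M ⧸ Q)),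
      (hQ'.trans Set.sdiff_subset).trans hM.2⟩ rfl)
  · by_contra hqp
    exact Set.disjoint_left.mp hQ hq ⟨associatedPrimes_submodule_subset Q hq, hqp⟩
  · have hfin := associatedPrimes.finite R M
    rw [← hn]
    exact Set.ncard_lt_ncard (hQ'.trans_ssubset (Set.sdiff_singleton_ssubset.mpr hp)) hfin

theorem MIsKEClosed.exists_smul_eq_zero (hX : MIsKEClosed R X) {p : Ideal R} (hp : p ∈ AssOf R X)
    (s : Finset R) (hs : (s : Set R) ⊆ p) :
    ∃ M, X M ∧ p ∈ associatedPrimes R M ∧ ∀ r ∈ s, ∀ x : M, r • x = 0 := by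
  classical
  induction s using Finset.induction_on with
  | empty =>
    obtain ⟨M, hM, hpM⟩ := hp
    exact ⟨M, hM, hpM, fun r hr ↦ absurd hr (Finset.notMem_empty r)⟩
  | insert r s _ ih =>
    rw [Finset.coe_insert, Set.insert_subset_iff] at hs
    obtain ⟨M, hM, hpM, hsM⟩ := ih hs.2
    refine ⟨_, hX.2.2.1 M M (LinearMap.lsmul R M r) hM hM, ?_, ?_⟩
    · obtain ⟨hprime, x, hx⟩ := isAssociatedPrime_iff.mp hpM
      have hrx : r • x = 0 :=
        (Submodule.mem_bot R).mp (Submodule.mem_colon_singleton.mp (hx.le hs.1))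
      refine isAssociatedPrime_iff.mpr ⟨hprime, ⟨x, hrx⟩, ?_⟩
      ext t
      rw [hx, Submodule.mem_colon_singleton, Submodule.mem_colon_singleton, Submodule.mem_bot,
        Submodule.mem_bot, ← Subtype.coe_inj]
      rfl
    · rintro t ht ⟨x, hx⟩
      apply Subtype.ext
      obtain rfl | ht := Finset.mem_insert.mp ht
      · exact hx
      · exact hsM t ht x

/-- Every `p ∈ Ass X` is the least associated prime of some member of `X`. -/
theorem MIsKEClosed.exists_associatedPrimes_subset_Ici (hX : MIsKEClosed R X) {p : Ideal R}
    (hp : p ∈ AssOf R X) :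
    ∃ M, X M ∧ p ∈ associatedPrimes R M ∧ associatedPrimes R M ⊆ Set.Ici p := by
  obtain ⟨s, rfl⟩ := (isNoetherianRing_iff_ideal_fg R).mp inferInstance p
  obtain ⟨M, hM, hpM, hs⟩ := hX.exists_smul_eq_zero hp s Ideal.subset_span
  refine ⟨M, hM, hpM, fun q hq ↦ Ideal.span_le.mpr fun r hr ↦ ?_⟩
  obtain ⟨-, x, rfl⟩ := isAssociatedPrime_iff.mp hq
  exact Submodule.mem_colon_singleton.mpr ((Submodule.mem_bot R).mpr (hs r hr x))

theorem MIsKEClosed.modAss_singleton_le (hX : MIsKEClosed R X)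
    (h : ∀ p ∈ AssOf R X, ∀ Y : ModuleCat.{u} R → Prop, MIsKEClosed R Y →
      AssOf R Y = {p} → (∀ M : ModuleCat.{u} R, Y M ↔ modAss R {p} M))
    (p : Ideal R) (hp : p ∈ AssOf R X) (M : ModuleCat.{u} R) (hM : modAss R {p} M) : X M := by
  induction p using WellFoundedGT.induction generalizing M with
  | _ p ih =>
  obtain ⟨N, hN, hpN, hNp⟩ := hX.exists_associatedPrimes_subset_Ici hp
  have := hX.1 N hN
  obtain ⟨Q, hQ, hQ'⟩ := exists_disjoint_associatedPrimes_and_quotient_subset (R := R) (M := N)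
    (associatedPrimes R N \ {p})
  have hXquot : X (ModuleCat.of R (N ⧸ Q)) :=
    hX.of_associatedPrimes_subset (Ψ := associatedPrimes R N \ {p})
      (fun q hq L hL ↦ ih q (lt_of_le_of_ne (hNp hq.1) (Ne.symm hq.2)) ⟨N, hN, hq.1⟩ L hL) _
      ⟨inferInstanceAs (Module.Finite R (N ⧸ Q)), hQ'⟩
  have hXQ := hX.of_quotient N Q hN hXquot
  have hQp : associatedPrimes R Q ⊆ {p} := fun q hq ↦ by
    by_contra hqp
    exact Set.disjoint_left.mp hQ hq ⟨associatedPrimes_submodule_subset Q hq, hqp⟩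
  have hpQ : p ∈ associatedPrimes R Q :=
    (associatedPrimes_subset_union_quotient Q hpN).resolve_right fun hq ↦ (hQ' hq).2 rfl
  refine ((h p hp _ (hX.inter_modAss {p}) (Set.Subset.antisymm ?_ ?_) M).mpr hM).1
  · rintro q ⟨L, hL, hq⟩
    exact hL.2 hq
  · rintro _ rfl
    exact ⟨_, ⟨hXQ, hQp⟩, hpQ⟩

end KEClosed

theorem KE_eq_modAss_primewise (R : Type u) [CommRing R] [IsNoetherianRing R]
    (Φ : Set (Ideal R)) (hΦ : ∀ p ∈ Φ, p.IsPrime)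
    (h : ∀ p ∈ Φ, ∀ Y : ModuleCat.{u} R → Prop, MIsKEClosed R Y →
      AssOf R Y = {p} → (∀ M : ModuleCat.{u} R, Y M ↔ modAss R {p} M)) :
    ∀ X : ModuleCat.{u} R → Prop, MIsKEClosed R X → AssOf R X = Φ →
      (∀ M : ModuleCat.{u} R, X M ↔ modAss R Φ M) := by
  rintro X hX rfl M
  exact ⟨fun hM ↦ ⟨hX.1 M hM, fun p hp ↦ ⟨M, hM, hp⟩⟩,
    hX.of_associatedPrimes_subset (hX.modAss_singleton_le h) M⟩
end

section
/- Let R be a commutative noetherian ring, I an ideal of R, and π : mod(R/I) → mod R the restriction-of-scalars functor. Let X be an extension-closed subcategory of mod R and p a prime ideal of R containing I, with image p̄ := p/I in Spec(R/I). If π^{-1}(X) contains mod^ass_{p̄}(R/I) (all finitely generated R/I-modules N with Ass_{R/I} N ⊆ {p̄}), then X contains mod^ass_{p} R (all finitely generated R-modules M with Ass_R M ⊆ {p}). -/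
/-! Statement 17: Let `R` be a commutative noetherian ring, `I` an ideal,
`π : mod (R/I) → mod R` the restriction-of-scalars functor, `X` an
extension-closed subcategory of `mod R`, and `p ⊇ I` a prime of `R` with
image `p̄ = p/I` in `Spec (R/I)`.  If `π⁻¹(X)` contains every finitely
generated `R/I`-module `N` with `Ass N ⊆ {p̄}`, then `X` contains every
finitely generated `R`-module `M` with `Ass M ⊆ {p}`. -/

open CategoryTheory

universe u

section Coprimary

variable {R : Type u} [CommRing R] {M : Type*} [AddCommGroup M] [Module R M]

/-- If `Ass M ⊆ {p}`, then every element outside `p` is a nonzerodivisor on `M`. -/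
lemma eq_zero_of_smul_eq_zero_of_associatedPrimes_subset [IsNoetherianRing R] {p : Ideal R}
    (h : associatedPrimes R M ⊆ {p}) {r : R} (hr : r ∉ p) {m : M} (hm : r • m = 0) : m = 0 := by
  by_contra hne
  obtain ⟨q, hq, hle⟩ := exists_le_isAssociatedPrime_of_isNoetherianRing R m hne
  obtain rfl : q = p := h hq
  exact hr (hle (Submodule.mem_colon_singleton.2 ((Submodule.mem_bot R).2 hm)))

/-- If `M` is finitely generated with `Ass M ⊆ {p}`, then some power of `p` annihilates `M`. -/
lemma exists_pow_le_annihilator_of_associatedPrimes_subset [IsNoetherianRing R] [Module.Finite R M]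
    {p : Ideal R} (h : associatedPrimes R M ⊆ {p}) :
    ∃ k : ℕ, p ^ k ≤ Module.annihilator R M := by
  refine Ideal.exists_pow_le_of_le_radical_of_fg ?_ p.fg_of_isNoetherianRing
  rw [← Ideal.sInf_minimalPrimes]
  refine le_sInf fun q hq => ?_
  obtain rfl : q = p :=
    h (Module.associatedPrimes.minimalPrimes_annihilator_subset_associatedPrimes R M hq)
  exact le_rfl

/-- If every element outside `p` is a nonzerodivisor on `M` and a power of `p` annihilates `M`,
then `Ass M ⊆ {p}`. -/
lemma associatedPrimes_subset_singleton [IsNoetherianRing R] {p : Ideal R}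
    (hreg : ∀ r : R, r ∉ p → ∀ m : M, r • m = 0 → m = 0) {k : ℕ}
    (hk : p ^ k ≤ Module.annihilator R M) : associatedPrimes R M ⊆ {p} := by
  intro q hq
  have hqp := hq.isPrime
  obtain ⟨-, x, hx⟩ := isAssociatedPrime_iff.1 hq
  have mem_iff (r : R) : r ∈ q ↔ r • x = 0 := by
    rw [hx, Submodule.mem_colon_singleton, Submodule.mem_bot]
  refine le_antisymm (fun r hr => ?_) (hqp.le_of_pow_le (n := k) fun r hr => ?_)
  · by_contra hrp
    have hx0 : x = 0 := hreg r hrp x ((mem_iff r).1 hr)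
    exact hqp.ne_top ((Ideal.eq_top_iff_one q).2 ((mem_iff 1).2 (by simp [hx0])))
  · exact (mem_iff r).2 (Module.mem_annihilator.1 (hk hr) x)

/-- If every element outside `p` is a nonzerodivisor on `M` and a power of `p` annihilates `M`,
then the `I`-torsion of `M`, as a module over `R ⧸ I`, has `Ass ⊆ {p / I}`. -/
lemma finite_and_associatedPrimes_torsionBySet_subset [IsNoetherianRing R] [Module.Finite R M] {I p : Ideal R}
    (hreg : ∀ r : R, r ∉ p → ∀ m : M, r • m = 0 → m = 0) {k : ℕ}
    (hk : p ^ k ≤ Module.annihilator R M) :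
    Module.Finite (R ⧸ I) (Submodule.torsionBySet R M I) ∧
      associatedPrimes (R ⧸ I) (Submodule.torsionBySet R M I) ⊆ {p.map (Ideal.Quotient.mk I)} := by
  refine ⟨Module.Finite.of_restrictScalars_finite R _ _, ?_⟩
  refine associatedPrimes_subset_singleton (k := k) (fun r hr m hm => ?_) ?_
  · obtain ⟨r, rfl⟩ := Ideal.Quotient.mk_surjective r
    rw [Submodule.torsionBySet.mk_smul] at hm
    exact Subtype.ext (hreg r (fun hrp => hr (Ideal.mem_map_of_mem _ hrp)) m
      (congrArg Subtype.val hm))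
  · rw [← Ideal.map_pow, Ideal.map_le_iff_le_comap]
    intro r hr
    rw [Ideal.mem_comap, Module.mem_annihilator]
    intro m
    rw [Submodule.torsionBySet.mk_smul]
    exact Subtype.ext (Module.mem_annihilator.1 (hk hr) m)

end Coprimary

/-- Filtering a `p`-coprimary module by its `I`-torsion: membership in an extension-closed
subcategory can be checked on modules over `R ⧸ I`. -/
lemma mem_of_pow_le_annihilator {R : Type u} [CommRing R] [IsNoetherianRing R]
    {I : Ideal R} {X : ModuleCat.{u} R → Prop} (hadd : MIsAdditive R X)
    (hext : MClosedUnderExtensions R X) {p : Ideal R}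
    (h : ∀ N : ModuleCat.{u} (R ⧸ I),
      modAss (R ⧸ I) {p.map (Ideal.Quotient.mk I)} N →
      X ((ModuleCat.restrictScalars (Ideal.Quotient.mk I)).obj N)) (k n : ℕ) :
    ∀ M : ModuleCat.{u} R, Module.Finite R M →
      (∀ r : R, r ∉ p → ∀ m : M, r • m = 0 → m = 0) →
      p ^ k ≤ Module.annihilator R M → I ^ n ≤ Module.annihilator R M → X M := by
  induction n with
  | zero =>
    intro M _ _ _ hn
    refine hadd.1 M ((Module.annihilator_eq_top_iff (R := R)).1 (top_le_iff.1 ?_))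
    simpa using hn
  | succ n ih =>
    intro M _ hreg hk hn
    have mem_iff (x : M) : x ∈ Submodule.torsionBySet R M I ↔ ∀ a ∈ I, a • x = 0 := by
      rw [Submodule.mem_torsionBySet_iff]
      exact Subtype.forall
    refine hext M (Submodule.torsionBySet R M I) ?_ (ih _ ?_ ?_ ?_ ?_)
    · refine hadd.2.1 _ _ ?_ (h (ModuleCat.of (R ⧸ I) (Submodule.torsionBySet R M I))
        (finite_and_associatedPrimes_torsionBySet_subset hreg hk))
      exact { AddEquiv.refl (Submodule.torsionBySet R M I) with map_smul' := fun _ _ => rfl }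
    · exact inferInstanceAs (Module.Finite R (M ⧸ Submodule.torsionBySet R M I))
    · intro r hr m hm
      obtain ⟨x, rfl⟩ := Submodule.Quotient.mk_surjective _ m
      have hrx := (mem_iff _).1 ((Submodule.Quotient.mk_eq_zero _).1 hm)
      refine (Submodule.Quotient.mk_eq_zero _).2 ((mem_iff x).2 fun a ha => ?_)
      exact hreg r hr _ (by rw [smul_comm, hrx a ha])
    · exact hk.trans ((Submodule.torsionBySet R M I).mkQ.annihilator_le_of_surjective
        (Submodule.mkQ_surjective _))
    · intro r hr
      refine Module.mem_annihilator.2 fun m => ?_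
      obtain ⟨x, rfl⟩ := Submodule.Quotient.mk_surjective _ m
      refine (Submodule.Quotient.mk_eq_zero _).2 ((mem_iff _).2 fun a ha => ?_)
      rw [smul_smul]
      exact Module.mem_annihilator.1 (hn (pow_succ' I n ▸ Ideal.mul_mem_mul ha hr)) x

theorem modAss_mem_of_quotient (R : Type u) [CommRing R] [IsNoetherianRing R]
    (I : Ideal R) (X : ModuleCat.{u} R → Prop)
    (hfg : IsSubcatOfFGMod R X) (hadd : MIsAdditive R X)
    (hext : MClosedUnderExtensions R X)
    (p : Ideal R) (hp : p.IsPrime) (hIp : I ≤ p)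
    (h : ∀ N : ModuleCat.{u} (R ⧸ I),
      modAss (R ⧸ I) {p.map (Ideal.Quotient.mk I)} N →
      X ((ModuleCat.restrictScalars (Ideal.Quotient.mk I)).obj N)) :
    ∀ M : ModuleCat.{u} R, modAss R {p} M → X M := by
  intro M ⟨_, hM⟩
  obtain ⟨k, hk⟩ := exists_pow_le_annihilator_of_associatedPrimes_subset hM
  exact mem_of_pow_le_annihilator hadd hext h k k M inferInstance
    (fun _ hr _ hm => eq_zero_of_smul_eq_zero_of_associatedPrimes_subset hM hr hm) hk
    ((Ideal.pow_right_mono hIp k).trans hk)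
end

section
/- Let R be a commutative noetherian ring and X an additive subcategory of mod R that is closed under finite direct sums and under kernels (Ker f ∈ X for every R-linear map f between modules of X). Then for every M ∈ X, the center Z_R(M) of the endomorphism ring End_R(M), regarded as a finitely generated R-module, belongs to X. -/
/-! Statement 18: Let `R` be a commutative noetherian ring and `X` an
additive subcategory of `mod R` closed under finite direct sums and kernels.
Then for every `M ∈ X`, the center `Z_R(M)` of the endomorphism ring
`End_R(M)`, regarded as an `R`-module, belongs to `X`. -/

open CategoryTheory

universe u

theorem MClosedUnderKernels.of_exact {R : Type u} [CommRing R] {X : ModuleCat.{u} R → Prop}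
    (hadd : MIsAdditive R X) (hker : MClosedUnderKernels R X)
    {A B C : Type u} [AddCommGroup A] [AddCommGroup B] [AddCommGroup C]
    [Module R A] [Module R B] [Module R C]
    (hB : X (ModuleCat.of R B)) (hC : X (ModuleCat.of R C))
    {g : A →ₗ[R] B} {f : B →ₗ[R] C} (hg : Function.Injective g) (hgf : Function.Exact g f) :
    X (ModuleCat.of R A) :=
  hadd.2.1 (ModuleCat.of R (LinearMap.ker f)) (ModuleCat.of R A)
    ((LinearEquiv.ofInjective g hg).trans
      (LinearEquiv.ofEq _ _ (LinearMap.exact_iff.mp hgf).symm)).symm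
    (hker (ModuleCat.of R B) (ModuleCat.of R C) f hB hC)

theorem MIsAdditive.pi_fin {R : Type u} [CommRing R] {X : ModuleCat.{u} R → Prop}
    (hadd : MIsAdditive R X) {M : Type u} [AddCommGroup M] [Module R M]
    (hM : X (ModuleCat.of R M)) (n : ℕ) : X (ModuleCat.of R (Fin n → M)) := by
  induction n with
  | zero => exact hadd.1 _ (inferInstanceAs (Subsingleton (Fin 0 → M)))
  | succ n ih =>
    exact hadd.2.1 (ModuleCat.of R (M × (Fin n → M))) (ModuleCat.of R (Fin (n + 1) → M))
      (Fin.consLinearEquiv R (fun _ => M)) (hadd.2.2 _ _ hM ih)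

theorem MClosedUnderKernels.linearMap_mem {R : Type u} [CommRing R]
    {X : ModuleCat.{u} R → Prop} (hadd : MIsAdditive R X) (hker : MClosedUnderKernels R X)
    (N : Type u) [AddCommGroup N] [Module R N] [Module.FinitePresentation R N]
    {M : Type u} [AddCommGroup M] [Module R M] (hM : X (ModuleCat.of R M)) :
    X (ModuleCat.of R (N →ₗ[R] M)) := by
  obtain ⟨n, m, f, g, hf, hfg⟩ := Module.FinitePresentation.exists_fin' R N
  have hfree (k : ℕ) : X (ModuleCat.of R ((Fin k → R) →ₗ[R] M)) :=
    hadd.2.1 (ModuleCat.of R (Fin k → M)) (ModuleCat.of R ((Fin k → R) →ₗ[R] M))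
      (LinearEquiv.piRing R M (Fin k) R).symm (hadd.pi_fin hM k)
  exact hker.of_exact hadd (hfree n) (hfree m) (LinearMap.lcomp_injective_of_surjective f hf)
    (LinearMap.exact_lcomp_of_exact_of_surjective M hfg hf)

theorem MClosedUnderKernels.center_mem {R : Type u} [CommRing R]
    {X : ModuleCat.{u} R → Prop} (hadd : MIsAdditive R X) (hker : MClosedUnderKernels R X)
    (A : Type u) [Ring A] [Algebra R A] [Module.Finite R A] (hA : X (ModuleCat.of R A)) :
    X (ModuleCat.of R (Subalgebra.center R A)) := by
  obtain ⟨n, a, ha⟩ := Module.Finite.exists_fin (R := R) (M := A)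
  refine hker.of_exact hadd hA (hadd.pi_fin hA n)
    (g := (Subalgebra.center R A).val.toLinearMap)
    (f := LinearMap.pi fun i => LinearMap.mulLeft R (a i) - LinearMap.mulRight R (a i))
    Subtype.val_injective fun x => ?_
  have hspan : x ∈ Subalgebra.center R A ↔ ∀ i, a i * x = x * a i := by
    rw [Subalgebra.mem_center_iff]
    refine ⟨fun h i => h (a i), fun h b => ?_⟩
    have hb : b ∈ Submodule.span R (Set.range a) := ha ▸ Submodule.mem_top
    induction hb using Submodule.span_induction with
    | mem b hb => obtain ⟨i, rfl⟩ := hb; exact h i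
    | zero => simp
    | add b c _ _ hb hc => rw [add_mul, mul_add, hb, hc]
    | smul r b _ hb => rw [smul_mul_assoc, mul_smul_comm, hb]
  have hrange : x ∈ Set.range (Subalgebra.center R A).val.toLinearMap ↔
      x ∈ Subalgebra.center R A :=
    ⟨fun ⟨y, hy⟩ => hy ▸ y.2, fun hx => ⟨⟨x, hx⟩, rfl⟩⟩
  rw [hrange, hspan]
  simp [funext_iff, sub_eq_zero]

theorem center_mem_of_closed_under_kernels (R : Type u) [CommRing R]
    [IsNoetherianRing R] (X : ModuleCat.{u} R → Prop)
    (hfg : IsSubcatOfFGMod R X) (hadd : MIsAdditive R X)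
    (hker : MClosedUnderKernels R X)
    (M : ModuleCat.{u} R) (hM : X M) :
    X (ModuleCat.of R (Subalgebra.center R (Module.End R M))) := by
  have : Module.Finite R M := hfg M hM
  have : Module.FinitePresentation R M := Module.finitePresentation_of_finite R M
  have hEnd : X (ModuleCat.of R (Module.End R M)) := hker.linearMap_mem hadd M hM
  have : Module.Finite R (Module.End R M) := hfg _ hEnd
  exact hker.center_mem hadd _ hEnd
end

section
/- Let R be a commutative noetherian ring with Krull dimension dim R ≤ 1, let Q(R) be the total ring of fractions of R, and let S be an R-subalgebra of Q(R) that is finitely generated as an R-module. Then there exist an integer n ≥ 0 and a strictly increasing chain of R-subalgebras R = S_0 ⊊ S_1 ⊊ ⋯ ⊊ S_n = S of Q(R) such that for each i = 0, …, n−1 there is a maximal ideal m_i of S_i with S_{i+1} ⊆ (m_i : m_i), where (m_i : m_i) := {a ∈ Q(R) : a·m_i ⊆ m_i}. -/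
/-!
Statement 19: Let `R` be a commutative noetherian ring with `dim R ≤ 1`, let
`Q(R)` be the total ring of fractions of `R`, and let `S` be an
`R`-subalgebra of `Q(R)` that is finitely generated as an `R`-module. Then
there exist `n ≥ 0` and a strictly increasing chain of `R`-subalgebras
`R = S₀ ⊊ S₁ ⊊ ⋯ ⊊ Sₙ = S` of `Q(R)` such that for each `i < n` there is a
maximal ideal `mᵢ` of `Sᵢ` with `S_{i+1} ⊆ (mᵢ : mᵢ)`, i.e. every element of
`S_{i+1}` multiplies `mᵢ` into `mᵢ`.
-/

universe u

section Chain

variable {R Q : Type*} [CommRing R] [CommRing Q] [Algebra R Q]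

/-- `A ⊊ B ⊆ (m : m)` for some maximal ideal `m` of `A`. -/
def IsMaximalMultiplierStep (A B : Subalgebra R Q) : Prop :=
  A < B ∧ ∃ m : Ideal A, m.IsMaximal ∧ ∀ x ∈ B, ∀ y ∈ m, ∃ z ∈ m, (z : Q) = x * (y : Q)

/-- The conductor `(A : x)` of an element into a subalgebra, as an ideal of `A`. -/
def conductorIdeal (A : Subalgebra R Q) (x : Q) : Ideal A where
  carrier := {a | (a : Q) * x ∈ A}
  add_mem' {a b} ha hb := by
    simpa [add_mul] using A.add_mem ha hb
  zero_mem' := by simp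
  smul_mem' c a ha := by
    simpa [mul_assoc] using A.mul_mem c.2 ha

theorem mem_conductorIdeal {A : Subalgebra R Q} {x : Q} {a : A} :
    a ∈ conductorIdeal A x ↔ (a : Q) * x ∈ A := Iff.rfl

/-- The elements of `S` that multiply the ideal `m` of `A` into itself. -/
def multiplierSubalgebra {A : Subalgebra R Q} (S : Subalgebra R Q) (m : Ideal A) :
    Subalgebra R Q where
  carrier := {x | x ∈ S ∧ ∀ y ∈ m, ∃ z ∈ m, (z : Q) = x * (y : Q)}
  mul_mem' {a b} ha hb := by
    refine ⟨S.mul_mem ha.1 hb.1, fun y hy => ?_⟩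
    obtain ⟨z, hz, hzy⟩ := hb.2 y hy
    obtain ⟨w, hw, hwz⟩ := ha.2 z hz
    exact ⟨w, hw, by rw [hwz, hzy, mul_assoc]⟩
  add_mem' {a b} ha hb := by
    refine ⟨S.add_mem ha.1 hb.1, fun y hy => ?_⟩
    obtain ⟨z, hz, hzy⟩ := ha.2 y hy
    obtain ⟨w, hw, hwy⟩ := hb.2 y hy
    exact ⟨z + w, m.add_mem hz hw, by simp [hzy, hwy, add_mul]⟩
  algebraMap_mem' r :=
    ⟨S.algebraMap_mem r, fun y hy =>
      ⟨algebraMap R A r * y, m.mul_mem_left _ hy, by simp⟩⟩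

theorem le_multiplierSubalgebra {A S : Subalgebra R Q} (hAS : A ≤ S) (m : Ideal A) :
    A ≤ multiplierSubalgebra S m := fun a ha =>
  ⟨hAS ha, fun y hy => ⟨⟨a, ha⟩ * y, m.mul_mem_left _ hy, by simp⟩⟩

/-- Among the elements of `S` outside `A`, one with maximal conductor has prime conductor. -/
theorem exists_isPrime_conductorIdeal {A S : Subalgebra R Q} [IsNoetherianRing A]
    (hAS : A < S) : ∃ x ∈ S, x ∉ A ∧ (conductorIdeal A x).IsPrime := by
  obtain ⟨s, hs, hsA⟩ := SetLike.exists_of_lt hAS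
  obtain ⟨I, ⟨x, hx, hxA, rfl⟩, hmax⟩ := set_has_maximal_iff_noetherian.mpr
    (inferInstanceAs (IsNoetherian A A))
    {I : Ideal A | ∃ x ∈ S, x ∉ A ∧ conductorIdeal A x = I} ⟨_, s, hs, hsA, rfl⟩
  refine ⟨x, hx, hxA, ⟨?_, fun {a b} hab => ?_⟩⟩
  · rw [Ideal.ne_top_iff_one, mem_conductorIdeal]
    simpa using hxA
  · by_contra! h
    have hle : conductorIdeal A x ≤ conductorIdeal A ((b : Q) * x) := fun c hc => by
      have := A.mul_mem b.2 hc
      rw [mem_conductorIdeal]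
      rwa [mul_left_comm] at this
    refine hmax _ ⟨(b : Q) * x, S.mul_mem (hAS.le b.2) hx, h.2, rfl⟩
      (lt_of_le_of_ne hle fun he => h.1 ?_)
    rw [he, mem_conductorIdeal, ← mul_assoc]
    exact hab

/-- An element integral over `A` multiplies a prime conductor `(A : x)` into itself. -/
theorem mul_mem_conductorIdeal_of_isIntegral {A : Subalgebra R Q} {x : Q} (hx : IsIntegral A x)
    (hp : (conductorIdeal A x).IsPrime) {y : A} (hy : y ∈ conductorIdeal A x) :
    (⟨(y : Q) * x, hy⟩ : A) ∈ conductorIdeal A x := by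
  obtain ⟨f, hf, hfx⟩ := hx
  set a : A := ⟨(y : Q) * x, hy⟩
  have hroot : (f.scaleRoots y).eval a = 0 := by
    apply Subtype.val_injective (p := fun q => q ∈ A)
    have h := Polynomial.scaleRoots_eval₂_eq_zero (p := f) (s := y) (algebraMap A Q) hfx
    have ha : algebraMap A Q y * x = algebraMap A Q a := rfl
    rw [ha, Polynomial.eval₂_at_apply] at h
    exact h
  have hmonic : (f.scaleRoots y).Monic := (Polynomial.monic_scaleRoots_iff y).mpr hf
  refine hp.mem_of_pow_mem f.natDegree ?_
  rw [Polynomial.eval_eq_sum_range, Polynomial.natDegree_scaleRoots, Finset.sum_range_succ] at hroot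
  have hlead : (f.scaleRoots y).coeff f.natDegree = 1 := by
    rw [Polynomial.coeff_scaleRoots_natDegree]; exact hf
  rw [hlead, one_mul] at hroot
  rw [eq_neg_of_add_eq_zero_right hroot]
  refine neg_mem (sum_mem fun i hi => Ideal.mul_mem_right _ _ ?_)
  rw [Polynomial.coeff_scaleRoots]
  refine Ideal.mul_mem_left _ _ (Ideal.pow_mem_of_mem _ hy _ ?_)
  have := Finset.mem_range.mp hi
  omega

/-- In dimension at most one, a prime containing a non-zero-divisor is maximal. -/
theorem isMaximal_of_mem_nonZeroDivisors (hdim : ringKrullDim R ≤ 1) {P : Ideal R}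
    (hP : P.IsPrime) {d : R} (hd : d ∈ nonZeroDivisors R) (hdP : d ∈ P) : P.IsMaximal := by
  have : Ring.KrullDimLE 1 R := Ring.krullDimLE_iff.mpr hdim
  refine (Ring.krullDimLE_one_iff.mp this P hP).resolve_left fun hmin => ?_
  exact Set.disjoint_left.mp (Ideal.disjoint_nonZeroDivisors_of_mem_minimalPrimes hmin) hdP hd

/-- A proper finite extension inside the total ring of fractions admits a first step. -/
theorem exists_isMaximalMultiplierStep [IsNoetherianRing R] [IsFractionRing R Q]
    (hdim : ringKrullDim R ≤ 1) {A S : Subalgebra R Q} (hS : (Subalgebra.toSubmodule S).FG)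
    (hAS : A < S) : ∃ B ≤ S, IsMaximalMultiplierStep A B := by
  have hSint : ∀ s ∈ S, IsIntegral R s := fun s hs => IsIntegral.of_mem_of_fg S hS s hs
  have : IsNoetherian R (Subalgebra.toSubmodule S) := isNoetherian_of_fg_of_noetherian _ hS
  have : IsNoetherian R A :=
    isNoetherian_of_le (s := Subalgebra.toSubmodule A) (t := Subalgebra.toSubmodule S) hAS.le
  have : IsNoetherianRing A := isNoetherian_of_tower R this
  have : Algebra.IsIntegral R A := Algebra.IsIntegral.of_finite R A
  obtain ⟨x, hxS, hxA, hp⟩ := exists_isPrime_conductorIdeal hAS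
  set m := conductorIdeal A x
  obtain ⟨⟨r, d⟩, hrd⟩ := IsLocalization.surj (nonZeroDivisors R) x
  have hdm : (d : R) ∈ m.comap (algebraMap R A) := by
    change algebraMap R Q d * x ∈ A
    rw [mul_comm, hrd]
    exact A.algebraMap_mem r
  have hmax : m.IsMaximal := Ideal.isMaximal_of_isIntegral_of_isMaximal_comap m
    (isMaximal_of_mem_nonZeroDivisors hdim (hp.comap _) d.2 hdm)
  refine ⟨multiplierSubalgebra S m, fun b hb => hb.1, ?_, m, hmax, fun b hb => hb.2⟩
  have hx : x ∈ multiplierSubalgebra S m := ⟨hxS, fun y hy =>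
    ⟨_, mul_mem_conductorIdeal_of_isIntegral (hSint x hxS).tower_top hp hy, mul_comm _ _⟩⟩
  exact SetLike.lt_iff_le_and_exists.mpr ⟨le_multiplierSubalgebra hAS.le m, x, hx, hxA⟩

theorem exists_chain_isMaximalMultiplierStep [IsNoetherianRing R] [IsFractionRing R Q]
    (hdim : ringKrullDim R ≤ 1) {S : Subalgebra R Q} (hS : (Subalgebra.toSubmodule S).FG)
    (A : Subalgebra R Q) (hAS : A ≤ S) :
    ∃ (n : ℕ) (c : ℕ → Subalgebra R Q), c 0 = A ∧ c n = S ∧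
      ∀ i < n, IsMaximalMultiplierStep (c i) (c (i + 1)) := by
  have : IsNoetherian R S :=
    isNoetherian_of_fg_of_noetherian (Subalgebra.toSubmodule S) hS
  induction hN : (Subalgebra.toSubmodule A).comap S.val.toLinearMap using
    WellFoundedGT.induction generalizing A with
  | ind N ih =>
    subst hN
    rcases hAS.eq_or_lt with rfl | hlt
    · exact ⟨0, fun _ => A, rfl, rfl, by simp⟩
    obtain ⟨B, hBS, hAB⟩ := exists_isMaximalMultiplierStep hdim hS hlt
    obtain ⟨b, hb, hbA⟩ := SetLike.exists_of_lt hAB.1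
    obtain ⟨n, c, hc0, hcn, hc⟩ := ih _ (SetLike.lt_iff_le_and_exists.mpr
      ⟨fun s hs => hAB.1.le hs, ⟨b, hBS hb⟩, hb, hbA⟩) B hBS rfl
    refine ⟨n + 1, fun i => Nat.casesOn i A c, rfl, hcn, fun i hi => ?_⟩
    cases i with
    | zero => simpa [hc0] using hAB
    | succ i => exact hc i (by omega)

end Chain

theorem exists_chain_of_subalgebras (R : Type u) [CommRing R]
    [IsNoetherianRing R] (hdim : ringKrullDim R ≤ 1)
    (S : Subalgebra R (FractionRing R))
    (hS : (Subalgebra.toSubmodule S).FG) :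
    ∃ (n : ℕ) (c : ℕ → Subalgebra R (FractionRing R)),
      c 0 = ⊥ ∧ c n = S ∧
      ∀ i < n, c i < c (i + 1) ∧
        ∃ m : Ideal (c i), m.IsMaximal ∧
          ∀ x ∈ c (i + 1), ∀ y ∈ m, ∃ z ∈ m,
            (z : FractionRing R) = x * (y : FractionRing R) :=
  exists_chain_isMaximalMultiplierStep hdim hS ⊥ bot_le
end
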